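/- arXiv:1805.07764 — 5 statements merged into one kernel-verified Lean document; each statement's English description precedes it below -/
import Mathlib

section
/- Let G be a finite 2-edge-connected graph with spanning tree T, let e be an edge of T, and let f ≠ e be any edge of G. Then {e,f} is a cut pair of G if and only if one of the following holds: (i) f is a non-tree edge and f is the unique non-tree edge g of G with e ∈ S_g; or (ii) f is a tree edge and for every non-tree edge g of G, e ∈ S_g if and only if f ∈ S_g. -/
open SimpleGraph

/-- A graph is `k`-edge-connected if it remains connected after the removal of any
set of fewer than `k` edges (i.e. any `k-1` edges). -/
def EdgeConnected {V : Type*} (G : SimpleGraph V) (k : ℕ) : Prop :=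
  ∀ S : Set (Sym2 V), S.ncard < k → (G.deleteEdges S).Connected

/-- `{e, f}` is a cut pair of `G`: both are edges, they are distinct, and removing
both disconnects `G`. -/
def CutPair {V : Type*} (G : SimpleGraph V) (e f : Sym2 V) : Prop :=
  e ∈ G.edgeSet ∧ f ∈ G.edgeSet ∧ e ≠ f ∧ ¬ (G.deleteEdges {e, f}).Connected

/-- `t ∈ S_g`: `t` lies on the unique path in the tree `T` between the endpoints of
the (non-tree) edge `g`. -/
def OnTreePath {V : Type*} (T : SimpleGraph V) (g t : Sym2 V) : Prop :=
  ∃ u v : V, g = s(u, v) ∧ ∀ p : T.Walk u v, p.IsPath → t ∈ p.edges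

theorem Bool.xor_eq_xor_iff_ne_iff_ne {a b c d : Bool} :
    (a ^^ b) = (c ^^ d) ↔ (a ≠ c ↔ b ≠ d) := by
  revert a b c d
  decide

namespace SimpleGraph

variable {V : Type*}

/-- `c` is constant along the edges of a connected graph only if it is constant. -/
theorem Connected.eq_of_forall_adj {G : SimpleGraph V} (hG : G.Connected) {α : Type*}
    {c : V → α} (hc : ∀ u v, G.Adj u v → c u = c v) (u v : V) : c u = c v := by
  obtain ⟨p⟩ := hG.preconnected u v
  induction p with
  | nil => rfl
  | cons h _ ih => exact (hc _ _ h).trans ih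

/-- A disconnected graph on a nonempty vertex set has a nonconstant two-colouring without
bichromatic edges. -/
theorem exists_bool_coloring_of_not_connected [Nonempty V] {G : SimpleGraph V}
    (hG : ¬ G.Connected) :
    ∃ c : V → Bool, (∀ u v, G.Adj u v → c u = c v) ∧ ∃ u v, c u ≠ c v := by
  classical
  have hpre : ¬ G.Preconnected := fun h => hG ⟨h⟩
  obtain ⟨x, y, hxy⟩ : ∃ x y, ¬ G.Reachable x y := by
    simpa only [Preconnected, not_forall] using hpre
  refine ⟨fun u => decide (G.Reachable x u), fun u v huv => ?_, x, y, ?_⟩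
  · exact decide_eq_decide.2 ⟨fun h => h.trans huv.reachable, fun h => h.trans huv.symm.reachable⟩
  · simp [hxy]

theorem onTreePath_iff_not_reachable {T : SimpleGraph V} {t : Sym2 V} {u v : V} :
    OnTreePath T s(u, v) t ↔ ¬ (T.deleteEdges {t}).Reachable u v := by
  classical
  constructor
  · rintro ⟨u', v', huv, h⟩ hr
    have hr' : (T.deleteEdges {t}).Reachable u' v' := by
      rcases Sym2.eq_iff.1 huv with ⟨rfl, rfl⟩ | ⟨rfl, rfl⟩
      exacts [hr, hr.symm]
    obtain ⟨p, hp⟩ := hr'.exists_isPath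
    have ht := h (p.mapLe (deleteEdges_le _)) ((Walk.isPath_mapLe _).2 hp)
    rw [Walk.edges_mapLe_eq_edges] at ht
    simpa using p.edges_subset_edgeSet ht
  · intro hr
    refine ⟨u, v, rfl, fun p _ => ?_⟩
    by_contra ht
    exact hr (p.toDeleteEdge t ht).reachable

/-- The two sides of a tree edge `t`: it lies on the tree path between `u` and `v` exactly
when `u` and `v` are on different sides. -/
theorem IsTree.exists_side {T : SimpleGraph V} (hT : T.IsTree) {t : Sym2 V}
    (ht : t ∈ T.edgeSet) :
    ∃ c : V → Bool, (∀ u v, OnTreePath T s(u, v) t ↔ c u ≠ c v) ∧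
      ∀ u v, T.Adj u v → (c u ≠ c v ↔ s(u, v) = t) := by
  classical
  induction t with | _ a b
  have hab : ¬ (T.deleteEdges {s(a, b)}).Reachable a b :=
    isBridge_iff.1 (isAcyclic_iff_forall_isBridge.1 hT.isAcyclic ht)
  have hadj : ∀ u v, T.Adj u v → s(u, v) ≠ s(a, b) →
      (T.deleteEdges {s(a, b)}).Reachable u v := fun u v h hne =>
    Adj.reachable (by simpa [deleteEdges_adj, h] using hne)
  have hstep : ∀ u v, T.Adj u v →
      ((T.deleteEdges {s(a, b)}).Reachable a v ∨ (T.deleteEdges {s(a, b)}).Reachable b v) →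
      ((T.deleteEdges {s(a, b)}).Reachable a u ∨ (T.deleteEdges {s(a, b)}).Reachable b u) := by
    intro u v h hv
    by_cases hne : s(u, v) = s(a, b)
    · rcases Sym2.eq_iff.1 hne with ⟨rfl, rfl⟩ | ⟨rfl, rfl⟩
      exacts [Or.inl .rfl, Or.inr .rfl]
    · exact hv.imp (·.trans (hadj u v h hne).symm) (·.trans (hadj u v h hne).symm)
  have hside : ∀ u, (T.deleteEdges {s(a, b)}).Reachable a u ∨
      (T.deleteEdges {s(a, b)}).Reachable b u := by
    have hwalk : ∀ u v, T.Walk u v →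
        ((T.deleteEdges {s(a, b)}).Reachable a v ∨ (T.deleteEdges {s(a, b)}).Reachable b v) →
        ((T.deleteEdges {s(a, b)}).Reachable a u ∨ (T.deleteEdges {s(a, b)}).Reachable b u) := by
      intro u v p hv
      induction p with
      | nil => exact hv
      | cons h _ ih => exact hstep _ _ h (ih hv)
    intro u
    obtain ⟨p⟩ := hT.connected.preconnected u a
    exact hwalk u a p (Or.inl .rfl)
  have hreach : ∀ u v, (T.deleteEdges {s(a, b)}).Reachable u v ↔
      ((T.deleteEdges {s(a, b)}).Reachable a u ↔ (T.deleteEdges {s(a, b)}).Reachable a v) := by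
    refine fun u v => ⟨fun h => ⟨(·.trans h), (·.trans h.symm)⟩, fun h => ?_⟩
    by_cases hu : (T.deleteEdges {s(a, b)}).Reachable a u
    · exact hu.symm.trans (h.1 hu)
    · exact ((hside u).resolve_left hu).symm.trans ((hside v).resolve_left (mt h.2 hu))
  refine ⟨fun u => decide ((T.deleteEdges {s(a, b)}).Reachable a u), fun u v => ?_,
    fun u v h => ?_⟩
  · rw [onTreePath_iff_not_reachable, hreach, ne_eq, decide_eq_decide]
  · rw [ne_eq, decide_eq_decide, ← hreach]
    refine ⟨fun hn => by_contra fun hne => hn (hadj u v h hne), fun heq => ?_⟩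
    rcases Sym2.eq_iff.1 heq with ⟨rfl, rfl⟩ | ⟨rfl, rfl⟩
    exacts [hab, fun hr => hab hr.symm]

end SimpleGraph

theorem stmt_3 {V : Type*} [Fintype V]
    (G : SimpleGraph V) (hG : EdgeConnected G 2)
    (T : SimpleGraph V) (hTG : T ≤ G) (hT : T.IsTree)
    (e f : Sym2 V) (he : e ∈ T.edgeSet) (hf : f ∈ G.edgeSet) (hfe : f ≠ e) :
    CutPair G e f ↔
      ((f ∉ T.edgeSet ∧ OnTreePath T f e ∧
          ∀ g ∈ G.edgeSet, g ∉ T.edgeSet → OnTreePath T g e → g = f) ∨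
        (f ∈ T.edgeSet ∧
          ∀ g ∈ G.edgeSet, g ∉ T.edgeSet → (OnTreePath T g e ↔ OnTreePath T g f))) := by
  have heG : e ∈ G.edgeSet := edgeSet_mono hTG he
  have hdel : ∀ x, (G.deleteEdges {x}).Connected := fun x => hG {x} (by simp)
  obtain ⟨ce, hce, hTe⟩ := hT.exists_side he
  simp only [CutPair, heG, hf, hfe.symm, ne_eq, not_false_eq_true, true_and]
  constructor
  · intro hcut
    have := hT.connected.nonempty
    obtain ⟨c, hc, x, y, hxy⟩ := exists_bool_coloring_of_not_connected hcut
    have hmono : ∀ u v, G.Adj u v → s(u, v) ≠ e → s(u, v) ≠ f → c u = c v :=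
      fun u v h h1 h2 => hc u v (by simp [deleteEdges_adj, h, h1, h2])
    have hcross_e : ∀ u v, s(u, v) = e → c u ≠ c v := by
      intro u v huv heq
      refine hxy ((hdel f).eq_of_forall_adj (fun a b hab => ?_) x y)
      rw [deleteEdges_adj, Set.mem_singleton_iff] at hab
      by_cases h : s(a, b) = e
      · rcases Sym2.eq_iff.1 (h.trans huv.symm) with ⟨rfl, rfl⟩ | ⟨rfl, rfl⟩
        exacts [heq, heq.symm]
      · exact hmono a b hab.1 h hab.2
    have hcross_f : ∀ u v, s(u, v) = f → c u ≠ c v := by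
      intro u v huv heq
      refine hxy ((hdel e).eq_of_forall_adj (fun a b hab => ?_) x y)
      rw [deleteEdges_adj, Set.mem_singleton_iff] at hab
      by_cases h : s(a, b) = f
      · rcases Sym2.eq_iff.1 (h.trans huv.symm) with ⟨rfl, rfl⟩ | ⟨rfl, rfl⟩
        exacts [heq, heq.symm]
      · exact hmono a b hab.1 hab.2 h
    by_cases hfT : f ∈ T.edgeSet
    · refine Or.inr ⟨hfT, fun g hg hgT => ?_⟩
      obtain ⟨cf, hcf, hTf⟩ := hT.exists_side hfT
      induction g with | _ u v
      have hxor := hT.connected.eq_of_forall_adj (c := fun w => c w ^^ (ce w ^^ cf w))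
        (fun a b hab => by
          have h1 := hTe a b hab
          have h2 := hTf a b hab
          have h3 := hmono a b (hTG hab)
          have h4 := hcross_e a b
          have h5 := hcross_f a b
          rw [Bool.xor_eq_xor_iff_ne_iff_ne, ne_eq (ce a ^^ cf a),
            Bool.xor_eq_xor_iff_ne_iff_ne]
          have h6 : s(a, b) = e → s(a, b) ≠ f := fun h h' => hfe (h'.symm.trans h)
          tauto) u v
      have huv := hmono u v hg (fun h => hgT (h ▸ he)) (fun h => hgT (h ▸ hfT))
      rw [Bool.xor_eq_xor_iff_ne_iff_ne, ne_eq (ce u ^^ cf u),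
        Bool.xor_eq_xor_iff_ne_iff_ne] at hxor
      rw [hce, hcf]
      tauto
    · have hxor := hT.connected.eq_of_forall_adj (c := fun w => c w ^^ ce w)
        (fun a b hab => by
          have h1 := hTe a b hab
          have h3 := hmono a b (hTG hab)
          have h4 := hcross_e a b
          have h5 : s(a, b) ≠ f := fun h => hfT (h ▸ hab)
          rw [Bool.xor_eq_xor_iff_ne_iff_ne]
          tauto)
      refine Or.inl ⟨hfT, ?_, fun g hg hgT hge => ?_⟩
      · induction f with | _ u v
        have h1 := hcross_f u v rfl
        rw [hce]
        exact (Bool.xor_eq_xor_iff_ne_iff_ne.1 (hxor u v)).1 h1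
      · induction g with | _ u v
        by_contra hgf
        have h1 := hmono u v hg (fun h => hgT (h ▸ he)) hgf
        exact (Bool.xor_eq_xor_iff_ne_iff_ne.1 (hxor u v)).2 ((hce u v).1 hge) h1
  · rintro (⟨hfT, -, huniq⟩ | ⟨hfT, hiff⟩) hconn
    · have hconst := hconn.eq_of_forall_adj (c := ce) fun u v huv => by
        simp only [deleteEdges_adj, Set.mem_insert_iff, Set.mem_singleton_iff, not_or] at huv
        by_cases hT' : T.Adj u v
        · exact not_not.1 (mt (hTe u v hT').1 huv.2.1)
        · exact not_not.1 fun h => huv.2.2 (huniq _ huv.1 hT' ((hce u v).2 h))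
      induction e with | _ a b
      exact (hTe a b he).2 rfl (hconst a b)
    · obtain ⟨cf, hcf, hTf⟩ := hT.exists_side hfT
      have hconst := hconn.eq_of_forall_adj (c := fun w => ce w ^^ cf w) fun u v huv => by
        simp only [deleteEdges_adj, Set.mem_insert_iff, Set.mem_singleton_iff, not_or] at huv
        by_cases hT' : T.Adj u v
        · have h1 := hTe u v hT'
          have h2 := hTf u v hT'
          rw [Bool.xor_eq_xor_iff_ne_iff_ne]
          tauto
        · have h := hiff s(u, v) huv.1 hT'
          rwa [hce, hcf, ← Bool.xor_eq_xor_iff_ne_iff_ne] at h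
      induction e with | _ a b
      have h1 := hTe a b he
      have h2 := hTf a b he
      have h3 := Bool.xor_eq_xor_iff_ne_iff_ne.1 (hconst a b)
      exact hfe (h2.1 (h3.1 (h1.2 rfl))).symm
end

section
/- Let H be a 2-edge-connected spanning subgraph of a finite graph G, let T be a spanning tree of H, let e be an edge of G not in H, and let {f,f'} be a cut pair of H. Then {f,f'} is not a cut pair of H ∪ {e} (i.e., e covers the cut pair {f,f'}) if and only if exactly one of f, f' belongs to S_e. -/
open SimpleGraph

/-- A vertex predicate preserved along edges is preserved along reachability. -/
lemma reachable_transfer {V : Type*} {G : SimpleGraph V} {P : V → Prop}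
    (hP : ∀ x y, G.Adj x y → P x → P y) {x y : V} (h : G.Reachable x y) : P x → P y := by
  obtain ⟨p⟩ := h
  induction p with
  | nil => exact id
  | cons hadj _ ih => exact fun hx => ih (hP _ _ hadj hx)

/-- If the edges of `G` crossing the vertex set `P` are exactly `f` and `f'`, then a trail uses
exactly one of them iff `P` separates its endpoints. -/
lemma xor_mem_edges_iff {V : Type*} {G : SimpleGraph V} {P : V → Prop} {f f' : Sym2 V}
    (hff : f ≠ f')
    (hcross : ∀ x y, G.Adj x y → (¬ (P x ↔ P y) ↔ s(x, y) = f ∨ s(x, y) = f'))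
    {u v : V} (p : G.Walk u v) (hp : p.IsTrail) :
    Xor (f ∈ p.edges) (f' ∈ p.edges) ↔ ¬ (P u ↔ P v) := by
  induction p with
  | nil => simp [Xor]
  | @cons u w v hadj p ih =>
    rw [Walk.isTrail_cons] at hp
    obtain ⟨hp, hnot⟩ := hp
    have ih := ih hp
    have hc := hcross u w hadj
    clear hcross
    rw [Walk.edges_cons, List.mem_cons, List.mem_cons]
    simp only [Xor] at ih ⊢
    grind

/-- In a tree, an edge lies on the tree path of `s(u, v)` iff it lies on any given path from `u`
to `v`. -/
lemma onTreePath_iff {V : Type*} {T : SimpleGraph V} (hT : T.IsTree) {u v : V}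
    (p : T.Walk u v) (hp : p.IsPath) (t : Sym2 V) :
    OnTreePath T s(u, v) t ↔ t ∈ p.edges := by
  have huniq : ∀ q : T.Walk u v, q.IsPath → q = p := fun q hq =>
    congrArg Subtype.val ((hT.isAcyclic.subsingleton_path u v).elim ⟨q, hq⟩ ⟨p, hp⟩)
  constructor
  · rintro ⟨x, y, hxy, h⟩
    rcases Sym2.eq_iff.1 hxy with ⟨rfl, rfl⟩ | ⟨rfl, rfl⟩
    · exact h p hp
    · simpa using h p.reverse hp.reverse
  · intro ht
    exact ⟨u, v, rfl, fun q hq => huniq q hq ▸ ht⟩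

/-- A cut pair of a 2-edge-connected graph consists exactly of the edges crossing some vertex set,
and both sides of that set stay connected after the removal of the pair. -/
lemma CutPair.exists_cut {V : Type*} {H : SimpleGraph V} (hH : EdgeConnected H 2)
    {f f' : Sym2 V} (hcut : CutPair H f f') :
    ∃ P : V → Prop, (∃ a, P a) ∧ (∃ b, ¬ P b) ∧
      (∀ x y, H.Adj x y → (¬ (P x ↔ P y) ↔ s(x, y) = f ∨ s(x, y) = f')) ∧
      ∀ x y, (P x ↔ P y) → (H.deleteEdges {f, f'}).Reachable x y := by
  obtain ⟨-, hf', hff, hdis⟩ := hcut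
  induction f' using Sym2.ind with | _ a b => ?_
  set K := H.deleteEdges {f, s(a, b)} with hK
  have hKadj : ∀ x y, K.Adj x y ↔ H.Adj x y ∧ s(x, y) ≠ f ∧ s(x, y) ≠ s(a, b) := by
    intro x y
    rw [hK, deleteEdges_adj, Set.mem_insert_iff, Set.mem_singleton_iff, not_or]
  have hdel : ∀ g : Sym2 V, (H.deleteEdges {g}).Connected := fun g => hH {g} (by simp)
  have hcover : ∀ x, K.Reachable a x ∨ K.Reachable b x := by
    intro x
    refine reachable_transfer (P := fun x => K.Reachable a x ∨ K.Reachable b x) ?_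
      ((hdel f).preconnected a x) (Or.inl (Reachable.refl a))
    intro x y hxy hx
    rw [deleteEdges_adj, Set.mem_singleton_iff] at hxy
    by_cases h : s(x, y) = s(a, b)
    · rcases Sym2.eq_iff.1 h with ⟨-, rfl⟩ | ⟨-, rfl⟩
      · exact Or.inr (Reachable.refl _)
      · exact Or.inl (Reachable.refl _)
    · have hr : K.Reachable x y := ((hKadj x y).2 ⟨hxy.1, hxy.2, h⟩).reachable
      exact hx.imp (·.trans hr) (·.trans hr)
  have hab : ¬ K.Reachable a b := by
    intro hab
    have hall : ∀ x, K.Reachable a x := fun x => (hcover x).elim id hab.trans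
    have : Nonempty V := ⟨a⟩
    exact hdis ⟨fun x y => (hall x).symm.trans (hall y)⟩
  have hpres : ∀ x y, K.Adj x y → (K.Reachable a x ↔ K.Reachable a y) := fun x y h =>
    ⟨(·.trans h.reachable), (·.trans h.reachable.symm)⟩
  have hfcross : ∀ x y, s(x, y) = f → ¬ (K.Reachable a x ↔ K.Reachable a y) := by
    intro x y hxy hiff
    refine hab (reachable_transfer (P := K.Reachable a) ?_
      ((hdel s(a, b)).preconnected a b) (Reachable.refl a))
    intro z w hzw
    rw [deleteEdges_adj, Set.mem_singleton_iff] at hzw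
    by_cases h : s(z, w) = f
    · rcases Sym2.eq_iff.1 (h.trans hxy.symm) with ⟨rfl, rfl⟩ | ⟨rfl, rfl⟩
      · exact hiff.1
      · exact hiff.2
    · exact (hpres z w ((hKadj z w).2 ⟨hzw.1, h, hzw.2⟩)).1
  refine ⟨K.Reachable a, ⟨a, Reachable.refl a⟩, ⟨b, hab⟩, fun x y hxy => ⟨?_, ?_⟩, ?_⟩
  · intro h
    by_contra! hne
    exact h (hpres x y ((hKadj x y).2 ⟨hxy, hne⟩))
  · rintro (h | h)
    · exact hfcross x y h
    · have ha : K.Reachable a a := Reachable.refl a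
      rcases Sym2.eq_iff.1 h with ⟨rfl, rfl⟩ | ⟨rfl, rfl⟩ <;> tauto
  · intro x y hiff
    by_cases hx : K.Reachable a x
    · exact hx.symm.trans (hiff.1 hx)
    · exact ((hcover x).resolve_left hx).symm.trans
        ((hcover y).resolve_left (mt hiff.2 hx))

theorem stmt_4 {V : Type*} [Fintype V]
    (G H : SimpleGraph V) (hHG : H ≤ G) (hH : EdgeConnected H 2)
    (T : SimpleGraph V) (hTH : T ≤ H) (hT : T.IsTree)
    (e : Sym2 V) (heG : e ∈ G.edgeSet) (heH : e ∉ H.edgeSet)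
    (f f' : Sym2 V) (hcut : CutPair H f f') :
    ¬ CutPair (H ⊔ fromEdgeSet {e}) f f' ↔
      Xor' (OnTreePath T e f) (OnTreePath T e f') := by
  obtain ⟨P, ⟨a, ha⟩, ⟨b, hb⟩, hcross, hreach⟩ := hcut.exists_cut hH
  obtain ⟨hf, hf', hff, -⟩ := hcut
  induction e using Sym2.ind with | _ u v => ?_
  obtain ⟨p, hp⟩ := (hT.connected.preconnected u v).exists_isPath
  change _ ↔ Xor (OnTreePath T s(u, v) f) (OnTreePath T s(u, v) f')
  rw [onTreePath_iff hT p hp, onTreePath_iff hT p hp,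
    xor_mem_edges_iff hff (fun x y h => hcross x y (hTH h)) p hp.isTrail]
  have hle : H ≤ H ⊔ fromEdgeSet {s(u, v)} := le_sup_left
  have hcon : ¬ CutPair (H ⊔ fromEdgeSet {s(u, v)}) f f' ↔
      ((H ⊔ fromEdgeSet {s(u, v)}).deleteEdges {f, f'}).Connected := by
    have h1 := edgeSet_mono hle hf
    have h2 := edgeSet_mono hle hf'
    unfold CutPair
    tauto
  rw [hcon]
  set L := (H ⊔ fromEdgeSet {s(u, v)}).deleteEdges {f, f'} with hL
  constructor
  · intro hconn huv
    refine hb (reachable_transfer (P := P) ?_ (hconn.preconnected a b) ha)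
    intro x y hxy
    rw [hL, deleteEdges_adj, sup_adj, fromEdgeSet_adj, Set.mem_insert_iff,
      Set.mem_singleton_iff, Set.mem_singleton_iff] at hxy
    obtain ⟨h | ⟨h, -⟩, hne⟩ := hxy
    · exact (not_not.1 (mt (hcross x y h).1 hne)).1
    · rcases Sym2.eq_iff.1 h with ⟨rfl, rfl⟩ | ⟨rfl, rfl⟩
      · exact huv.1
      · exact huv.2
  · intro huv
    have hKL : H.deleteEdges {f, f'} ≤ L := deleteEdges_mono hle
    have hreachL : ∀ x y, (P x ↔ P y) → L.Reachable x y := fun x y h => (hreach x y h).mono hKL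
    have huvL : L.Reachable u v := by
      refine Adj.reachable ?_
      rw [hL, deleteEdges_adj, sup_adj, fromEdgeSet_adj, Set.mem_insert_iff,
        Set.mem_singleton_iff]
      refine ⟨Or.inr ⟨rfl, G.ne_of_adj heG⟩, ?_⟩
      rintro (rfl | rfl)
      · exact heH hf
      · exact heH hf'
    have : Nonempty V := ⟨a⟩
    have hall : ∀ x, L.Reachable u x := by
      intro x
      by_cases hx : P u ↔ P x
      · exact hreachL u x hx
      · exact huvL.trans (hreachL v x (by tauto))
    exact ⟨fun x y => (hall x).symm.trans (hall y)⟩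
end

section
/- Let H be a finite 2-edge-connected graph with spanning tree T, let t be an edge of T, and let e be a non-tree edge of H with t ∈ S_e. Then every edge f of H such that {t,f} is a cut pair of H lies on the fundamental cycle Cyc_e = S_e ∪ {e}. -/
open SimpleGraph

theorem stmt_5 {V : Type*} [Fintype V]
    (H : SimpleGraph V) (hH : EdgeConnected H 2)
    (T : SimpleGraph V) (hTH : T ≤ H) (hT : T.IsTree)
    (t : Sym2 V) (ht : t ∈ T.edgeSet)
    (e : Sym2 V) (heH : e ∈ H.edgeSet) (heT : e ∉ T.edgeSet)
    (hte : OnTreePath T e t)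
    (f : Sym2 V) (hcut : CutPair H t f) :
    OnTreePath T e f ∨ f = e := by
  rw [or_iff_not_imp_right]
  intro hfe
  obtain ⟨u, v, rfl, hpath⟩ := hte
  refine ⟨u, v, rfl, fun p hp => ?_⟩
  by_contra hfp
  have hsub : ∀ x ∈ p.edges, x ∈ (H.deleteEdges {f}).edgeSet := fun x hx => by
    rw [edgeSet_deleteEdges]
    exact ⟨edgeSet_mono hTH (p.edges_subset_edgeSet hx), fun h => hfp (h ▸ hx)⟩
  have hadj : (H.deleteEdges {f}).Adj v u := by
    rw [deleteEdges_adj, Sym2.eq_swap]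
    exact ⟨(H.mem_edgeSet.1 heH).symm, fun h => hfe h.symm⟩
  have hcyc : (Walk.cons hadj (p.transfer _ hsub)).IsCycle := by
    rw [Walk.cons_isCycle_iff, Walk.edges_transfer, Sym2.eq_swap]
    exact ⟨hp.transfer hsub, fun h => heT (p.edges_subset_edgeSet h)⟩
  have htcyc : t ∈ (Walk.cons hadj (p.transfer _ hsub)).edges := by
    simp [hpath p hp]
  have hconn : (H.deleteEdges {f}).Connected := hH {f} (by simp)
  have hbridge : ¬ (H.deleteEdges {f}).IsBridge t := fun h =>
    h.notMem_edges_of_isCycle hcyc htcyc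
  apply hcut.2.2.2
  induction t with
  | h x y =>
    have hdel := hconn.connected_delete_edge_of_not_isBridge hbridge
    rwa [deleteEdges_deleteEdges, Set.union_comm] at hdel
end

section
/- Let G = (V,E) be a finite graph, let b ≥ 1, and let F ⊆ E. If F is an induced edge cut of G, then every b-bit circulation φ of G satisfies ⊕_{e∈F} φ(e) = 0 (the all-zero vector), where ⊕ denotes coordinatewise addition modulo 2. If F is not an induced edge cut of G, then exactly a 2^{−b} fraction of all b-bit circulations of G satisfy ⊕_{e∈F} φ(e) = 0. Consequently, for a uniformly random b-bit circulation φ, Pr[⊕_{e∈F} φ(e) = 0] equals 1 if F is an induced edge cut and equals 2^{−b} otherwise. -/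
open SimpleGraph

/-- A binary circulation of `G`: a set of edges of `G` in which every vertex has
even degree. -/
def IsCirculation {V : Type*} (G : SimpleGraph V) (φ : Set (Sym2 V)) : Prop :=
  φ ⊆ G.edgeSet ∧ ∀ v : V, Even {e ∈ φ | v ∈ e}.ncard

/-- `δ(S)`: the set of edges of `G` with exactly one endpoint in `S`. -/
def crossingEdges {V : Type*} (G : SimpleGraph V) (S : Set V) : Set (Sym2 V) :=
  {e | e ∈ G.edgeSet ∧ ∃ u v : V, e = s(u, v) ∧ u ∈ S ∧ v ∉ S}

/-- An induced edge cut of `G`: a set of edges of the form `δ(S)` for some `S ⊆ V`. -/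
def IsInducedEdgeCut {V : Type*} (G : SimpleGraph V) (F : Set (Sym2 V)) : Prop :=
  ∃ S : Set V, F = crossingEdges G S

/-- A `b`-bit circulation: a function assigning each edge of `G` a vector of `b`
bits such that each coordinate is (the indicator of) a binary circulation. -/
def IsBitCirculation {V : Type*} (G : SimpleGraph V) (b : ℕ)
    (φ : ↥G.edgeSet → (Fin b → ZMod 2)) : Prop :=
  ∀ i : Fin b, IsCirculation G {e : Sym2 V | ∃ he : e ∈ G.edgeSet, φ ⟨e, he⟩ i = 1}

/-- A family of bits is a `b`-bit circulation iff its sum around every vertex vanishes. -/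
theorem isBitCirculation_iff_sum_eq_zero {V : Type*} [DecidableEq V]
    (G : SimpleGraph V) [Fintype ↥G.edgeSet] (b : ℕ) (φ : ↥G.edgeSet → (Fin b → ZMod 2)) :
    IsBitCirculation G b φ ↔
      ∀ v : V, ∑ e : ↥G.edgeSet, (if v ∈ (e : Sym2 V) then (1 : ZMod 2) else 0) • φ e = 0 := by
  have key : ∀ (i : Fin b) (v : V),
      Even {e ∈ {e : Sym2 V | ∃ he : e ∈ G.edgeSet, φ ⟨e, he⟩ i = 1} | v ∈ e}.ncard ↔
        (∑ e : ↥G.edgeSet, (if v ∈ (e : Sym2 V) then (1 : ZMod 2) else 0) • φ e) i = 0 := by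
    intro i v
    have himage : {e ∈ {e : Sym2 V | ∃ he : e ∈ G.edgeSet, φ ⟨e, he⟩ i = 1} | v ∈ e} =
        Subtype.val '' (↑(Finset.univ.filter
          (fun e : ↥G.edgeSet => v ∈ (e : Sym2 V) ∧ φ e i = 1)) : Set ↥G.edgeSet) := by
      ext e
      simp only [Set.mem_ofPred_eq, Set.mem_image, Finset.coe_filter, Finset.mem_univ, true_and,
        Subtype.exists, exists_and_right, exists_eq_right]
      tauto
    rw [himage, Set.ncard_image_of_injective _ Subtype.val_injective, Set.ncard_coe_finset,
      ← ZMod.natCast_eq_zero_iff_even, Finset.card_filter, Finset.sum_apply, Nat.cast_sum]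
    refine Eq.congr (Finset.sum_congr rfl fun e _ => ?_) rfl
    have hbit : ∀ a : ZMod 2, a = 0 ∨ a = 1 := by decide
    rcases hbit (φ e i) with h | h <;> by_cases hv : v ∈ (e : Sym2 V) <;> simp [h, hv]
  constructor
  · intro h v
    funext i
    exact (key i v).1 ((h i).2 v)
  · intro h i
    exact ⟨fun e he => he.1, fun v => (key i v).2 (congrFun (h v) i)⟩

/-- Induced edge cuts are exactly the linear combinations of vertex stars over `ZMod 2`. -/
theorem isInducedEdgeCut_iff_exists_sum {V : Type*} [Fintype V] [DecidableEq V]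
    (G : SimpleGraph V) (F : Finset (Sym2 V)) (hF : ↑F ⊆ G.edgeSet) :
    IsInducedEdgeCut G ↑F ↔ ∃ c : V → ZMod 2, ∀ e : ↥G.edgeSet,
      (if (e : Sym2 V) ∈ F then (1 : ZMod 2) else 0) =
        ∑ v : V, c v * (if v ∈ (e : Sym2 V) then (1 : ZMod 2) else 0) := by
  have hbit : ∀ a : ZMod 2, a = 0 ∨ a = 1 := by decide
  have hends : ∀ (c : V → ZMod 2) (u w : V), u ≠ w →
      ∑ v : V, c v * (if v ∈ s(u, w) then (1 : ZMod 2) else 0) = c u + c w := by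
    intro c u w huw
    have hfilter : Finset.univ.filter (fun v => v ∈ s(u, w)) = {u, w} := by
      ext v
      simp
    simp only [mul_ite, mul_one, mul_zero]
    rw [← Finset.sum_filter, hfilter, Finset.sum_pair huw]
  have hmem : ∀ (S : Set V) (u w : V), G.Adj u w →
      (s(u, w) ∈ crossingEdges G S ↔ ¬ (u ∈ S ↔ w ∈ S)) := by
    intro S u w huw
    constructor
    · rintro ⟨-, x, y, hxy, hx, hy⟩
      rcases Sym2.eq_iff.1 hxy with ⟨rfl, rfl⟩ | ⟨rfl, rfl⟩ <;> tauto
    · intro h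
      refine ⟨huw, ?_⟩
      by_cases hu : u ∈ S
      · exact ⟨u, w, rfl, hu, by tauto⟩
      · exact ⟨w, u, Sym2.eq_swap, by tauto, hu⟩
  constructor
  · rintro ⟨S, hS⟩
    classical
    refine ⟨fun v => if v ∈ S then 1 else 0, ?_⟩
    rintro ⟨e, he⟩
    induction e using Sym2.ind with
    | _ u w =>
      have huw : G.Adj u w := he
      have hFe : s(u, w) ∈ F ↔ ¬ (u ∈ S ↔ w ∈ S) := by
        rw [← hmem S u w huw, ← hS, Finset.mem_coe]
      rw [hends _ u w huw.ne]
      have h2 : (1 + 1 : ZMod 2) = 0 := by decide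
      by_cases hu : u ∈ S <;> by_cases hw : w ∈ S <;> simp [hFe, hu, hw, h2]
  · rintro ⟨c, hc⟩
    refine ⟨{v | c v = 1}, ?_⟩
    have hiff : ∀ e ∈ G.edgeSet, e ∈ F ↔ e ∈ crossingEdges G {v | c v = 1} := by
      intro e he
      have hce := hc ⟨e, he⟩
      induction e using Sym2.ind with
      | _ u w =>
        have huw : G.Adj u w := he
        rw [hmem _ u w huw]
        rw [hends _ u w huw.ne] at hce
        have h2 : (1 + 1 : ZMod 2) = 0 := by decide
        rcases hbit (c u) with hu | hu <;> rcases hbit (c w) with hw | hw <;>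
          simpa [hu, hw, h2] using hce
    ext e
    exact ⟨fun he => (hiff e (hF he)).1 he, fun he => (hiff e he.1).2 he⟩

/-- An edge set that is not an induced edge cut meets some binary circulation in an odd number
of edges. -/
theorem exists_circulation_sum_eq_one {V : Type*} [Fintype V] [DecidableEq V]
    (G : SimpleGraph V) [Fintype ↥G.edgeSet] (F : Finset (Sym2 V)) (hF : ↑F ⊆ G.edgeSet)
    (hcut : ¬ IsInducedEdgeCut G ↑F) :
    ∃ x : ↥G.edgeSet → ZMod 2,
      (∀ v : V, ∑ e : ↥G.edgeSet, (if v ∈ (e : Sym2 V) then (1 : ZMod 2) else 0) * x e = 0) ∧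
      ∑ e : ↥G.edgeSet, (if (e : Sym2 V) ∈ F then (1 : ZMod 2) else 0) * x e = 1 := by
  have hbit : ∀ a : ZMod 2, a ≠ 0 → a = 1 := by decide
  by_contra! hno
  apply hcut
  rw [isInducedEdgeCut_iff_exists_sum G F hF]
  let functional : (↥G.edgeSet → ZMod 2) → Module.Dual (ZMod 2) (↥G.edgeSet → ZMod 2) :=
    fun a => ∑ e, a e • LinearMap.proj e
  have happly : ∀ a x, functional a x = ∑ e, a e * x e := by
    intro a x
    simp [functional]
  have hspan : functional (fun e => if (e : Sym2 V) ∈ F then 1 else 0) ∈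
      Submodule.span (ZMod 2) (Set.range fun v : V =>
        functional (fun e => if v ∈ (e : Sym2 V) then 1 else 0)) := by
    apply mem_span_of_iInf_ker_le_ker
    intro x hx
    simp only [Submodule.mem_iInf, LinearMap.mem_ker, happly] at hx ⊢
    by_contra h
    exact hno x hx (hbit _ h)
  obtain ⟨c, hc⟩ := (Submodule.mem_span_range_iff_exists_fun _).1 hspan
  refine ⟨c, fun e => ?_⟩
  classical
  have := congrArg (fun f => f (Pi.single e 1)) hc
  simpa [happly, LinearMap.sum_apply, Pi.single_apply] using this.symm

/-- The sum of a `b`-bit circulation over an induced edge cut vanishes. -/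
theorem IsBitCirculation.sum_eq_zero_of_isInducedEdgeCut {V : Type*} [Fintype V] [DecidableEq V]
    {G : SimpleGraph V} [Fintype ↥G.edgeSet] {b : ℕ} {φ : ↥G.edgeSet → (Fin b → ZMod 2)}
    (hφ : IsBitCirculation G b φ) {F : Finset (Sym2 V)} (hF : ↑F ⊆ G.edgeSet)
    (hcut : IsInducedEdgeCut G ↑F) :
    (∑ e : ↥G.edgeSet, if (e : Sym2 V) ∈ F then φ e else 0) = 0 := by
  obtain ⟨c, hc⟩ := (isInducedEdgeCut_iff_exists_sum G F hF).1 hcut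
  rw [isBitCirculation_iff_sum_eq_zero] at hφ
  calc (∑ e : ↥G.edgeSet, if (e : Sym2 V) ∈ F then φ e else 0)
      = ∑ e : ↥G.edgeSet, (if (e : Sym2 V) ∈ F then (1 : ZMod 2) else 0) • φ e := by
        simp only [ite_smul, one_smul, zero_smul]
    _ = ∑ v : V, c v • ∑ e : ↥G.edgeSet,
          (if v ∈ (e : Sym2 V) then (1 : ZMod 2) else 0) • φ e := by
        simp only [hc, Finset.sum_smul, mul_smul, Finset.smul_sum]
        exact Finset.sum_comm
    _ = 0 := by simp only [hφ, smul_zero, Finset.sum_const_zero]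

/-- If `F` is not an induced edge cut, the `b`-bit circulations summing to zero over `F` make up
a `2 ^ (-b)` fraction of all `b`-bit circulations. -/
theorem two_pow_mul_ncard_isBitCirculation {V : Type*} [Fintype V] [DecidableEq V]
    (G : SimpleGraph V) [Fintype ↥G.edgeSet] (b : ℕ) (F : Finset (Sym2 V))
    (hF : ↑F ⊆ G.edgeSet) (hcut : ¬ IsInducedEdgeCut G ↑F) :
    2 ^ b * {φ : ↥G.edgeSet → (Fin b → ZMod 2) | IsBitCirculation G b φ ∧
        (∑ e : ↥G.edgeSet, if (e : Sym2 V) ∈ F then φ e else 0) = 0}.ncard =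
      {φ : ↥G.edgeSet → (Fin b → ZMod 2) | IsBitCirculation G b φ}.ncard := by
  obtain ⟨x, hx, hxF⟩ := exists_circulation_sum_eq_one G F hF hcut
  have hsum : ∀ φ : ↥G.edgeSet → (Fin b → ZMod 2),
      (∑ e : ↥G.edgeSet, if (e : Sym2 V) ∈ F then φ e else 0) =
        ∑ e : ↥G.edgeSet, (if (e : Sym2 V) ∈ F then (1 : ZMod 2) else 0) • φ e := by
    intro φ
    simp only [ite_smul, one_smul, zero_smul]
  simp only [isBitCirculation_iff_sum_eq_zero, hsum]
  have hlin : ∀ (a : ↥G.edgeSet → ZMod 2) (φ : ↥G.edgeSet → (Fin b → ZMod 2))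
      (y : Fin b → ZMod 2),
      ∑ e, a e • (φ + fun e => x e • y) e = ∑ e, a e • φ e + (∑ e, a e * x e) • y := by
    intro a φ y
    simp only [Pi.add_apply, smul_add, Finset.sum_add_distrib, Finset.sum_smul, mul_smul]
  set Z : Set (↥G.edgeSet → (Fin b → ZMod 2)) := {φ | (∀ v : V,
      ∑ e : ↥G.edgeSet, (if v ∈ (e : Sym2 V) then (1 : ZMod 2) else 0) • φ e = 0) ∧
    ∑ e : ↥G.edgeSet, (if (e : Sym2 V) ∈ F then (1 : ZMod 2) else 0) • φ e = 0}
  set f : (↥G.edgeSet → (Fin b → ZMod 2)) × (Fin b → ZMod 2) → (↥G.edgeSet → (Fin b → ZMod 2)) :=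
    fun p => p.1 + fun e => x e • p.2
  have himage : {φ : ↥G.edgeSet → (Fin b → ZMod 2) | ∀ v : V,
      ∑ e : ↥G.edgeSet, (if v ∈ (e : Sym2 V) then (1 : ZMod 2) else 0) • φ e = 0} =
      f '' (Z ×ˢ Set.univ) := by
    ext φ
    constructor
    · intro hφ
      set y := ∑ e : ↥G.edgeSet, (if (e : Sym2 V) ∈ F then (1 : ZMod 2) else 0) • φ e with hy
      refine ⟨(φ + fun e => x e • (-y), y), ⟨⟨fun v => ?_, ?_⟩, trivial⟩, ?_⟩
      · rw [hlin, hx, hφ v, zero_smul, add_zero]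
      · rw [hlin, hxF, one_smul, ← hy, add_neg_cancel]
      · funext e
        simp [f]
    · rintro ⟨⟨ψ, y⟩, ⟨⟨hψ, -⟩, -⟩, rfl⟩ v
      simp only [f]
      rw [hlin, hx, hψ v, zero_smul, add_zero]
  have hinj : Set.InjOn f (Z ×ˢ Set.univ) := by
    rintro ⟨ψ, y⟩ ⟨⟨-, hψ⟩, -⟩ ⟨ψ', y'⟩ ⟨⟨-, hψ'⟩, -⟩ h
    have hyy : y = y' := by
      have := congrArg (fun φ : ↥G.edgeSet → (Fin b → ZMod 2) =>
        ∑ e : ↥G.edgeSet, (if (e : Sym2 V) ∈ F then (1 : ZMod 2) else 0) • φ e) h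
      simp only [f] at this hψ hψ'
      rwa [hlin, hlin, hψ, hψ', hxF, one_smul, one_smul, zero_add, zero_add] at this
    subst hyy
    exact Prod.ext (add_right_cancel h) rfl
  rw [himage, hinj.ncard_image, Set.ncard_prod, Set.ncard_univ, mul_comm]
  simp [Nat.card_eq_fintype_card]

theorem stmt_11 {V : Type*} [Fintype V] [DecidableEq V]
    (G : SimpleGraph V) [Fintype ↥G.edgeSet]
    (b : ℕ) (hb : 1 ≤ b)
    (F : Finset (Sym2 V)) (hF : ↑F ⊆ G.edgeSet) :
    (IsInducedEdgeCut G ↑F →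
        ∀ φ : ↥G.edgeSet → (Fin b → ZMod 2), IsBitCirculation G b φ →
          (∑ e : ↥G.edgeSet, if (e : Sym2 V) ∈ F then φ e else 0) = 0) ∧
    (¬ IsInducedEdgeCut G ↑F →
        2 ^ b * {φ : ↥G.edgeSet → (Fin b → ZMod 2) | IsBitCirculation G b φ ∧
            (∑ e : ↥G.edgeSet, if (e : Sym2 V) ∈ F then φ e else 0) = 0}.ncard =
          {φ : ↥G.edgeSet → (Fin b → ZMod 2) | IsBitCirculation G b φ}.ncard) ∧
    (IsInducedEdgeCut G ↑F →
        ({φ : ↥G.edgeSet → (Fin b → ZMod 2) | IsBitCirculation G b φ ∧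
              (∑ e : ↥G.edgeSet, if (e : Sym2 V) ∈ F then φ e else 0) = 0}.ncard : ℝ) /
            ({φ : ↥G.edgeSet → (Fin b → ZMod 2) | IsBitCirculation G b φ}.ncard : ℝ)
          = 1) ∧
    (¬ IsInducedEdgeCut G ↑F →
        ({φ : ↥G.edgeSet → (Fin b → ZMod 2) | IsBitCirculation G b φ ∧
              (∑ e : ↥G.edgeSet, if (e : Sym2 V) ∈ F then φ e else 0) = 0}.ncard : ℝ) /
            ({φ : ↥G.edgeSet → (Fin b → ZMod 2) | IsBitCirculation G b φ}.ncard : ℝ)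
          = 1 / 2 ^ b) := by
  have hzero : IsBitCirculation G b 0 := by
    simp [isBitCirculation_iff_sum_eq_zero]
  have hpos : ({φ : ↥G.edgeSet → (Fin b → ZMod 2) | IsBitCirculation G b φ}.ncard : ℝ) ≠ 0 :=
    Nat.cast_ne_zero.2 ((Set.ncard_ne_zero_of_mem (a := 0) hzero))
  refine ⟨fun hcut φ hφ => hφ.sum_eq_zero_of_isInducedEdgeCut hF hcut,
    two_pow_mul_ncard_isBitCirculation G b F hF, fun hcut => ?_, fun hcut => ?_⟩
  · have hiff : ∀ φ : ↥G.edgeSet → (Fin b → ZMod 2), IsBitCirculation G b φ ∧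
        (∑ e : ↥G.edgeSet, if (e : Sym2 V) ∈ F then φ e else 0) = 0 ↔ IsBitCirculation G b φ :=
      fun φ => and_iff_left_of_imp fun hφ => hφ.sum_eq_zero_of_isInducedEdgeCut hF hcut
    simp only [hiff]
    exact div_self hpos
  · rw [div_eq_div_iff hpos (by positivity), one_mul, mul_comm]
    exact_mod_cast two_pow_mul_ncard_isBitCirculation G b F hF hcut
end

section
/- Let G = (V,E) be a finite graph with m edges, let b ≥ 1, and let φ be a uniformly random b-bit circulation of G. Then with probability at least 1 − m²·2^{−b}, the following holds simultaneously for all pairs of distinct edges e, f ∈ E: φ(e) = φ(f) if and only if {e,f} is an induced edge cut of G. -/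
open SimpleGraph

open scoped Classical in
/-- The sum, modulo two, of the values of `x` on the edges incident to `v`. -/
noncomputable def vertexSum {V : Type*} (G : SimpleGraph V) [Fintype ↥G.edgeSet] (v : V) :
    (↥G.edgeSet → ZMod 2) →ₗ[ZMod 2] ZMod 2 :=
  ∑ e : ↥G.edgeSet, if v ∈ (e : Sym2 V) then LinearMap.proj e else 0

open scoped Classical in
theorem vertexSum_apply {V : Type*} (G : SimpleGraph V) [Fintype ↥G.edgeSet] (v : V)
    (x : ↥G.edgeSet → ZMod 2) :
    vertexSum G v x = ∑ e : ↥G.edgeSet, if v ∈ (e : Sym2 V) then x e else 0 := by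
  simp only [vertexSum, LinearMap.sum_apply]
  refine Finset.sum_congr rfl fun e _ => ?_
  split_ifs <;> simp

theorem ZMod.two_eq_zero_or_one (a : ZMod 2) : a = 0 ∨ a = 1 := by
  revert a; decide

theorem isCirculation_iff_vertexSum {V : Type*} (G : SimpleGraph V) [Fintype ↥G.edgeSet]
    (x : ↥G.edgeSet → ZMod 2) :
    IsCirculation G {e : Sym2 V | ∃ he : e ∈ G.edgeSet, x ⟨e, he⟩ = 1} ↔
      ∀ v, vertexSum G v x = 0 := by
  classical
  have hsub : {e : Sym2 V | ∃ he : e ∈ G.edgeSet, x ⟨e, he⟩ = 1} ⊆ G.edgeSet :=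
    fun e he => he.1
  refine (and_iff_right hsub).trans (forall_congr' fun v => ?_)
  have himage : {e ∈ {e : Sym2 V | ∃ he : e ∈ G.edgeSet, x ⟨e, he⟩ = 1} | v ∈ e} =
      Subtype.val '' {e : ↥G.edgeSet | x e = 1 ∧ v ∈ (e : Sym2 V)} := by
    ext e
    simp only [Set.mem_ofPred_eq, Set.mem_image, Subtype.exists, exists_and_right,
      exists_eq_right]
  have hcard : vertexSum G v x =
      (({e : ↥G.edgeSet | x e = 1 ∧ v ∈ (e : Sym2 V)}.ncard : ℕ) : ZMod 2) := by
    rw [vertexSum_apply, Set.ncard_eq_toFinset_card', Finset.card_eq_sum_ones]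
    simp only [Set.toFinset_ofPred, Finset.sum_filter, Nat.cast_sum]
    refine Finset.sum_congr rfl fun e _ => ?_
    rcases ZMod.two_eq_zero_or_one (x e) with h | h <;> simp [h]
  rw [himage, Set.ncard_image_of_injective _ Subtype.val_injective, hcard,
    ZMod.natCast_eq_zero_iff_even]

theorem isBitCirculation_iff_vertexSum {V : Type*} (G : SimpleGraph V) [Fintype ↥G.edgeSet]
    (b : ℕ) (φ : ↥G.edgeSet → (Fin b → ZMod 2)) :
    IsBitCirculation G b φ ↔ ∀ i v, vertexSum G v (fun e => φ e i) = 0 :=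
  forall_congr' fun i => isCirculation_iff_vertexSum G fun e => φ e i

open scoped Classical in
/-- The sum over the endpoints of an edge of the indicator of `S` is the indicator of
the edge crossing `S`. -/
theorem sum_endpoints_indicator {V : Type*} [Fintype V] (G : SimpleGraph V) (S : Set V)
    (e : ↥G.edgeSet) :
    (∑ v : V, if v ∈ (e : Sym2 V) then (if v ∈ S then (1 : ZMod 2) else 0) else 0) =
      if (e : Sym2 V) ∈ crossingEdges G S then 1 else 0 := by
  obtain ⟨e, he⟩ := e
  induction e using Sym2.ind with
  | _ u w =>
    have huw : u ≠ w := G.ne_of_adj he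
    have hcross : s(u, w) ∈ crossingEdges G S ↔ (u ∈ S ∧ w ∉ S) ∨ (w ∈ S ∧ u ∉ S) := by
      constructor
      · rintro ⟨-, a, c, hac, ha, hc⟩
        rcases Sym2.eq_iff.1 hac with ⟨rfl, rfl⟩ | ⟨rfl, rfl⟩
        · exact Or.inl ⟨ha, hc⟩
        · exact Or.inr ⟨ha, hc⟩
      · rintro (⟨h, h'⟩ | ⟨h, h'⟩)
        · exact ⟨he, u, w, rfl, h, h'⟩
        · exact ⟨he, w, u, Sym2.eq_swap, h, h'⟩
    rw [← Finset.sum_filter]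
    have hfilter : ({v | v ∈ s(u, w)} : Finset V) = {u, w} := by
      ext v; simp
    rw [hfilter, Finset.sum_pair huw, if_congr hcross rfl rfl]
    by_cases hu : u ∈ S <;> by_cases hw : w ∈ S <;> simp [hu, hw]
    decide

open scoped Classical in
theorem sum_indicator_mul_vertexSum {V : Type*} [Fintype V] (G : SimpleGraph V)
    [Fintype ↥G.edgeSet] (S : Set V) (x : ↥G.edgeSet → ZMod 2) :
    (∑ v : V, (if v ∈ S then (1 : ZMod 2) else 0) * vertexSum G v x) =
      ∑ e : ↥G.edgeSet, if (e : Sym2 V) ∈ crossingEdges G S then x e else 0 := by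
  simp only [vertexSum_apply, Finset.mul_sum]
  rw [Finset.sum_comm]
  refine Finset.sum_congr rfl fun e _ => ?_
  have h := congrArg (· * x e) (sum_endpoints_indicator G S e)
  simp only [Finset.sum_mul, ite_mul, one_mul, zero_mul] at h
  rw [← h]
  refine Finset.sum_congr rfl fun v _ => ?_
  split_ifs <;> simp

/-- Two edges form an induced edge cut exactly when every circulation takes the same
value on them. -/
theorem isInducedEdgeCut_pair_iff {V : Type*} [Fintype V] (G : SimpleGraph V)
    [Fintype ↥G.edgeSet] {e f : ↥G.edgeSet} (hef : e ≠ f) :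
    IsInducedEdgeCut G {(e : Sym2 V), (f : Sym2 V)} ↔
      ∀ x : ↥G.edgeSet → ZMod 2, (∀ v, vertexSum G v x = 0) → x e = x f := by
  classical
  constructor
  · rintro ⟨S, hS⟩ x hx
    have h := sum_indicator_mul_vertexSum G S x
    simp only [hx, mul_zero, Finset.sum_const_zero, ← hS] at h
    rw [← Finset.sum_filter] at h
    have hfilter : ({g | (g : Sym2 V) ∈ ({(e : Sym2 V), (f : Sym2 V)} : Set (Sym2 V))} :
        Finset ↥G.edgeSet) = {e, f} := by
      ext g; simp [Subtype.ext_iff]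
    rw [hfilter, Finset.sum_pair hef] at h
    exact CharTwo.add_eq_zero.1 h.symm
  · intro h
    have hker : ⨅ v, LinearMap.ker (vertexSum G v) ≤
        LinearMap.ker (LinearMap.proj (R := ZMod 2) (φ := fun _ : ↥G.edgeSet => ZMod 2) e +
          LinearMap.proj f) := by
      intro x hx
      simp only [Submodule.mem_iInf, LinearMap.mem_ker] at hx
      simpa [CharTwo.add_eq_zero] using h x hx
    obtain ⟨c, hc⟩ := (Submodule.mem_span_range_iff_exists_fun (ZMod 2)).1
      (mem_span_of_iInf_ker_le_ker hker)
    refine ⟨{v | c v = 1}, ?_⟩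
    have hmem : ∀ g : ↥G.edgeSet, (g : Sym2 V) ∈ ({(e : Sym2 V), (f : Sym2 V)} : Set _) ↔
        (g : Sym2 V) ∈ crossingEdges G {v | c v = 1} := by
      intro g
      have hg := LinearMap.congr_fun hc (Pi.single g 1)
      simp only [LinearMap.sum_apply, LinearMap.smul_apply, smul_eq_mul,
        LinearMap.add_apply, LinearMap.proj_apply] at hg
      have hsum : (∑ v, c v * vertexSum G v (Pi.single g 1)) =
          ∑ a : ↥G.edgeSet, if (a : Sym2 V) ∈ crossingEdges G {v | c v = 1}
            then (Pi.single g 1 : ↥G.edgeSet → ZMod 2) a else 0 := by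
        rw [← sum_indicator_mul_vertexSum]
        refine Finset.sum_congr rfl fun v _ => ?_
        rcases ZMod.two_eq_zero_or_one (c v) with h | h <;> simp [h]
      rw [hsum] at hg
      have hsingle : (∑ a : ↥G.edgeSet, if (a : Sym2 V) ∈ crossingEdges G {v | c v = 1}
          then (Pi.single g 1 : ↥G.edgeSet → ZMod 2) a else 0) =
          if (g : Sym2 V) ∈ crossingEdges G {v | c v = 1} then 1 else 0 := by
        rw [Finset.sum_eq_single g]
        · simp
        · intro a _ hag; simp [hag]
        · simp
      rw [hsingle] at hg
      simp only [Set.mem_insert_iff, Set.mem_singleton_iff, ← Subtype.ext_iff]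
      simp only [Pi.single_apply] at hg
      grind
    ext g
    constructor
    · rintro (rfl | rfl)
      · exact (hmem e).1 (by simp)
      · exact (hmem f).1 (by simp)
    · intro hg
      exact (hmem ⟨g, hg.1⟩).2 hg

/-- If two edges do not form an induced edge cut, at most a `2⁻ᵇ` fraction of the `b`-bit
circulations agree on them. -/
theorem ncard_agreeing_mul_two_pow_le {V : Type*} [Fintype V] (G : SimpleGraph V)
    [Fintype ↥G.edgeSet] (b : ℕ) {e f : ↥G.edgeSet} (hef : e ≠ f)
    (hcut : ¬ IsInducedEdgeCut G {(e : Sym2 V), (f : Sym2 V)}) :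
    {φ : ↥G.edgeSet → (Fin b → ZMod 2) | IsBitCirculation G b φ ∧ φ e = φ f}.ncard * 2 ^ b ≤
      {φ : ↥G.edgeSet → (Fin b → ZMod 2) | IsBitCirculation G b φ}.ncard := by
  rw [isInducedEdgeCut_pair_iff G hef] at hcut
  push Not at hcut
  obtain ⟨x, hx, hne⟩ := hcut
  have hdiff : x e - x f = 1 :=
    (ZMod.two_eq_zero_or_one _).resolve_left (sub_ne_zero.2 hne)
  have hpow : (Set.univ : Set (Fin b → ZMod 2)).ncard = 2 ^ b := by
    simp [Set.ncard_univ]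
  rw [← hpow, ← Set.ncard_prod]
  refine Set.ncard_le_ncard_of_injOn
    (fun p : (↥G.edgeSet → Fin b → ZMod 2) × (Fin b → ZMod 2) => fun g i => p.1 g i + p.2 i * x g)
    ?_ ?_ (Set.toFinite _)
  · rintro ⟨φ, s⟩ ⟨⟨hφ, -⟩, -⟩
    rw [isBitCirculation_iff_vertexSum] at hφ
    refine (isBitCirculation_iff_vertexSum G b fun g i => φ g i + s i * x g).2 fun i v => ?_
    have hlin : (fun g => φ g i + s i * x g) = (fun g => φ g i) + s i • x := rfl
    simp only [hlin, map_add, map_smul, hφ i v, hx v, smul_zero, add_zero]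
  · rintro ⟨φ, s⟩ ⟨⟨-, hφ⟩, -⟩ ⟨ψ, t⟩ ⟨⟨-, hψ⟩, -⟩ h
    have hval : ∀ g i, φ g i + s i * x g = ψ g i + t i * x g :=
      fun g i => congrFun (congrFun h g) i
    simp only at hφ hψ
    have hst : s = t := by
      ext i
      have h1 := hval e i
      have h2 := hval f i
      rw [hφ, hψ] at h1
      linear_combination h1 - h2 - (s i - t i) * hdiff
    subst hst
    refine Prod.ext ?_ rfl
    ext g i
    exact add_right_cancel (hval g i)

/-- For a uniformly random `b`-bit circulation `φ`, with probability at least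
`1 - m² · 2⁻ᵇ` (expressed by counting circulations), for all pairs of distinct
edges `e ≠ f` we have `φ(e) = φ(f)` iff `{e, f}` is an induced edge cut. -/
theorem stmt_12 {V : Type*} [Fintype V]
    (G : SimpleGraph V) [Fintype ↥G.edgeSet] (b : ℕ) (hb : 1 ≤ b) :
    ((1 : ℝ) - (G.edgeSet.ncard : ℝ) ^ 2 / 2 ^ b) *
        ({φ : ↥G.edgeSet → (Fin b → ZMod 2) | IsBitCirculation G b φ}.ncard : ℝ) ≤
      ({φ : ↥G.edgeSet → (Fin b → ZMod 2) | IsBitCirculation G b φ ∧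
          ∀ e f : ↥G.edgeSet, e ≠ f →
            (φ e = φ f ↔
              IsInducedEdgeCut G {(e : Sym2 V), (f : Sym2 V)})}.ncard : ℝ) := by
  classical
  set A := {φ : ↥G.edgeSet → (Fin b → ZMod 2) | IsBitCirculation G b φ}
  set B := {φ : ↥G.edgeSet → (Fin b → ZMod 2) | IsBitCirculation G b φ ∧
    ∀ e f : ↥G.edgeSet, e ≠ f →
      (φ e = φ f ↔ IsInducedEdgeCut G {(e : Sym2 V), (f : Sym2 V)})}
  let D : ↥G.edgeSet × ↥G.edgeSet → Set (↥G.edgeSet → (Fin b → ZMod 2)) := fun p =>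
    {φ | (IsBitCirculation G b φ ∧ φ p.1 = φ p.2) ∧
      p.1 ≠ p.2 ∧ ¬ IsInducedEdgeCut G {(p.1 : Sym2 V), (p.2 : Sym2 V)}}
  have hcover : A ⊆ B ∪ ⋃ p ∈ (Finset.univ : Finset (↥G.edgeSet × ↥G.edgeSet)), D p := by
    intro φ hφ
    by_cases hbad : ∃ p, φ ∈ D p
    · obtain ⟨p, hp⟩ := hbad
      exact Or.inr (Set.mem_biUnion (Finset.mem_univ p) hp)
    · refine Or.inl ⟨hφ, fun e f hef => ⟨fun heq => ?_, fun hcut => ?_⟩⟩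
      · by_contra hcut
        exact hbad ⟨(e, f), ⟨hφ, heq⟩, hef, hcut⟩
      · ext i
        exact (isInducedEdgeCut_pair_iff G hef).1 hcut _
          ((isBitCirculation_iff_vertexSum G b φ).1 hφ i)
  have hD : ∀ p, ((D p).ncard : ℝ) ≤ (A.ncard : ℝ) / 2 ^ b := by
    intro p
    rw [le_div_iff₀ (by positivity)]
    by_cases hp : p.1 ≠ p.2 ∧ ¬ IsInducedEdgeCut G {(p.1 : Sym2 V), (p.2 : Sym2 V)}
    · have h := ncard_agreeing_mul_two_pow_le G b hp.1 hp.2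
      have hDp : D p = {φ | IsBitCirculation G b φ ∧ φ p.1 = φ p.2} := by
        ext φ
        exact and_iff_left hp
      rw [hDp]
      exact_mod_cast h
    · have hDp : D p = ∅ := Set.eq_empty_of_forall_notMem fun φ hφ => hp hφ.2
      simp [hDp]
  have hcard : (A.ncard : ℝ) ≤ B.ncard + ∑ p, ((D p).ncard : ℝ) := by
    have h := (Set.ncard_le_ncard hcover (Set.toFinite _)).trans ((Set.ncard_union_le _ _).trans
      (Nat.add_le_add_left (Finset.set_ncard_biUnion_le Finset.univ D) _))
    exact_mod_cast h
  have hsum : ∑ p, ((D p).ncard : ℝ) ≤ (G.edgeSet.ncard : ℝ) ^ 2 * ((A.ncard : ℝ) / 2 ^ b) := by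
    refine (Finset.sum_le_card_nsmul _ _ _ fun p _ => hD p).trans_eq ?_
    rw [Finset.card_univ, Fintype.card_prod, ← Nat.card_eq_fintype_card, Nat.card_coe_set_eq]
    simp [pow_two]
  rw [sub_mul, one_mul, div_mul_eq_mul_div, mul_div_assoc]
  linarith
end
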